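/- Let F be the field with two elements and let C^o, C^s, C^u be F-vector spaces. Suppose given F-linear maps d_oo : C^o → C^o, d_os : C^o → C^s, d_uo : C^u → C^o, d_us : C^u → C^s, b_ss : C^s → C^s, b_uu : C^u → C^u, b_us : C^u → C^s, b_su : C^s → C^u satisfying the eight identities: (i) d_oo∘d_oo + d_uo∘b_su∘d_os = 0; (ii) d_os∘d_oo + b_ss∘d_os + d_us∘b_su∘d_os = 0; (iii) d_oo∘d_uo + d_uo∘b_uu + d_uo∘b_su∘d_us = 0; (iv) d_os∘d_uo + b_ss∘d_us + d_us∘b_uu + d_us∘b_su∘d_us + b_us = 0; (v) b_ss∘b_ss + b_us∘b_su = 0; (vi) b_ss∘b_us + b_us∘b_uu = 0; (vii) b_su∘b_ss + b_uu∘b_su = 0; (viii) b_su∘b_us + b_uu∘b_uu = 0. Define the operator D_check on C^o ⊕ C^s by D_check(x,y) = (d_oo x + (d_uo∘b_su) y, d_os x + (b_ss + d_us∘b_su) y), the operator D_hat on C^o ⊕ C^u by D_hat(x,y) = (d_oo x + d_uo y, (b_su∘d_os) x + (b_uu + b_su∘d_us) y), and the operator D_bar on C^s ⊕ C^u by D_bar(x,y)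 = (b_ss x + b_us y, b_su x + b_uu y). Then D_check∘D_check = 0, D_hat∘D_hat = 0, and D_bar∘D_bar = 0; that is, each of the three operators is a differential. -/

import Mathlib

/-- The three Morse-theoretic chain groups of a manifold with boundary, with
differentials assembled from the eight trajectory-counting operators, are chain
complexes: each of `D_check`, `D_hat`, `D_bar` squares to zero. -/
theorem morse_boundary_differentials_square_to_zero
    (Co Cs Cu : Type*)
    [AddCommGroup Co] [Module (ZMod 2) Co]
    [AddCommGroup Cs] [Module (ZMod 2) Cs]
    [AddCommGroup Cu] [Module (ZMod 2) Cu]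
    (doo : Co →ₗ[ZMod 2] Co) (dos : Co →ₗ[ZMod 2] Cs)
    (duo : Cu →ₗ[ZMod 2] Co) (dus : Cu →ₗ[ZMod 2] Cs)
    (bss : Cs →ₗ[ZMod 2] Cs) (buu : Cu →ₗ[ZMod 2] Cu)
    (bus : Cu →ₗ[ZMod 2] Cs) (bsu : Cs →ₗ[ZMod 2] Cu)
    (h1 : doo ∘ₗ doo + duo ∘ₗ bsu ∘ₗ dos = 0)
    (h2 : dos ∘ₗ doo + bss ∘ₗ dos + dus ∘ₗ bsu ∘ₗ dos = 0)
    (h3 : doo ∘ₗ duo + duo ∘ₗ buu + duo ∘ₗ bsu ∘ₗ dus = 0)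
    (h4 : dos ∘ₗ duo + bss ∘ₗ dus + dus ∘ₗ buu + dus ∘ₗ bsu ∘ₗ dus + bus = 0)
    (h5 : bss ∘ₗ bss + bus ∘ₗ bsu = 0)
    (h6 : bss ∘ₗ bus + bus ∘ₗ buu = 0)
    (h7 : bsu ∘ₗ bss + buu ∘ₗ bsu = 0)
    (h8 : bsu ∘ₗ bus + buu ∘ₗ buu = 0)
    (Dcheck : Co × Cs →ₗ[ZMod 2] Co × Cs)
    (hDcheck : ∀ x y, Dcheck (x, y) =
      (doo x + (duo ∘ₗ bsu) y, dos x + (bss + dus ∘ₗ bsu) y))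
    (Dhat : Co × Cu →ₗ[ZMod 2] Co × Cu)
    (hDhat : ∀ x y, Dhat (x, y) =
      (doo x + duo y, (bsu ∘ₗ dos) x + (buu + bsu ∘ₗ dus) y))
    (Dbar : Cs × Cu →ₗ[ZMod 2] Cs × Cu)
    (hDbar : ∀ x y, Dbar (x, y) = (bss x + bus y, bsu x + buu y)) :
    Dcheck ∘ₗ Dcheck = 0 ∧ Dhat ∘ₗ Dhat = 0 ∧ Dbar ∘ₗ Dbar = 0 := by
  have e1 (x) : doo (doo x) + duo (bsu (dos x)) = 0 := LinearMap.congr_fun h1 x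
  have e2 (x) : dos (doo x) + bss (dos x) + dus (bsu (dos x)) = 0 := LinearMap.congr_fun h2 x
  have e3 (x) : doo (duo x) + duo (buu x) + duo (bsu (dus x)) = 0 := LinearMap.congr_fun h3 x
  have e4 (x) : dos (duo x) + bss (dus x) + dus (buu x) + dus (bsu (dus x)) + bus x = 0 :=
    LinearMap.congr_fun h4 x
  have e5 (x) : bss (bss x) + bus (bsu x) = 0 := LinearMap.congr_fun h5 x
  have e6 (x) : bss (bus x) + bus (buu x) = 0 := LinearMap.congr_fun h6 x
  have e7 (x) : bsu (bss x) + buu (bsu x) = 0 := LinearMap.congr_fun h7 x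
  have e8 (x) : bsu (bus x) + buu (buu x) = 0 := LinearMap.congr_fun h8 x
  refine ⟨LinearMap.ext ?_, LinearMap.ext ?_, LinearMap.ext ?_⟩ <;> rintro ⟨x, y⟩
  · have e7' := congrArg duo (e7 y)
    have e7'' := congrArg dus (e7 y)
    simp only [map_add, map_zero] at e7' e7''
    simp only [LinearMap.comp_apply, LinearMap.add_apply, hDcheck, map_add, LinearMap.zero_apply]
    refine Prod.ext ?_ ?_ <;> dsimp only [Prod.fst_zero, Prod.snd_zero]
    · linear_combination (norm := abel) e1 x + e3 (bsu y) + e7'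
        - ZModModule.add_self (duo (buu (bsu y)))
    · linear_combination (norm := abel) e2 x + e4 (bsu y) + e5 y + e7''
        - ZModModule.add_self (dus (buu (bsu y))) - ZModModule.add_self (bus (bsu y))
  · have e2' := congrArg bsu (e2 x)
    have e4' := congrArg bsu (e4 y)
    simp only [map_add, map_zero] at e2' e4'
    simp only [LinearMap.comp_apply, LinearMap.add_apply, hDhat, map_add, LinearMap.zero_apply]
    refine Prod.ext ?_ ?_ <;> dsimp only [Prod.fst_zero, Prod.snd_zero]
    · linear_combination (norm := abel) e1 x + e3 y
    · linear_combination (norm := abel) e2' + e7 (dos x) + e4' + e8 y + e7 (dus y)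
        - ZModModule.add_self (bsu (bss (dos x))) - ZModModule.add_self (bsu (bss (dus y)))
        - ZModModule.add_self (bsu (bus y))
  · simp only [LinearMap.comp_apply, hDbar, map_add, LinearMap.zero_apply]
    refine Prod.ext ?_ ?_ <;> dsimp only [Prod.fst_zero, Prod.snd_zero]
    · linear_combination (norm := abel) e5 x + e6 y
    · linear_combination (norm := abel) e7 x + e8 y
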